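/- For γ ∈ (0,1), ε > 0, and k ∈ {0,1,2}, the integral ∫_0^∞ x^k e^{x^γ - εx} dx is finite, and as ε → 0 it equals √(2π/(1-γ)) · γ^{1/(2(1-γ))} · ε^{-(2-γ)/(2(1-γ))} · exp((1-γ)(γ/ε)^{γ/(1-γ)}) · (γ/ε)^{k/(1-γ)} · (1 + O(ε^{γ/(2(1-γ))})). -/

import Mathlib

open Real Set Filter Topology Asymptotics MeasureTheory

/-- Monotonicity on the right of `1`. -/
lemma lap_right (F F' : ℝ → ℝ) (y : ℝ) (hy : 1 ≤ y)
    (hd : ∀ x, 1 ≤ x → HasDerivAt F (F' x) x) (h1 : F 1 = 0)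
    (hp : ∀ x, 1 ≤ x → 0 ≤ F' x) : 0 ≤ F y := by
  have hm : MonotoneOn F (Ici 1) := by
    apply monotoneOn_of_deriv_nonneg (convex_Ici 1)
    · exact fun x hx => (hd x hx).continuousAt.continuousWithinAt
    · intro x hx
      rw [interior_Ici] at hx
      exact (hd x (le_of_lt hx)).differentiableAt.differentiableWithinAt
    · intro x hx
      rw [interior_Ici] at hx
      rw [(hd x (le_of_lt hx)).deriv]
      exact hp x (le_of_lt hx)
  have := hm (mem_Ici.2 le_rfl) (mem_Ici.2 hy) hy
  linarith

/-- Monotonicity on the left of `1`. -/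
lemma lap_left (F F' : ℝ → ℝ) (y : ℝ) (hy : y ≤ 1)
    (hd : ∀ x, y ≤ x → x ≤ 1 → HasDerivAt F (F' x) x) (h1 : F 1 = 0)
    (hp : ∀ x, y ≤ x → x ≤ 1 → F' x ≤ 0) : 0 ≤ F y := by
  have hm : AntitoneOn F (Icc y 1) := by
    apply antitoneOn_of_deriv_nonpos (convex_Icc y 1)
    · exact fun x hx => (hd x hx.1 hx.2).continuousAt.continuousWithinAt
    · intro x hx
      have hx := interior_subset hx
      exact (hd x hx.1 hx.2).differentiableAt.differentiableWithinAt
    · intro x hx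
      have hx := interior_subset hx
      rw [(hd x hx.1 hx.2).deriv]
      exact hp x hx.1 hx.2
  have := hm (left_mem_Icc.2 hy) (right_mem_Icc.2 hy) hy
  linarith

/-- The normalised phase function. -/
noncomputable def lapPhi (γ y : ℝ) : ℝ := γ * y + 1 - γ - y ^ γ

lemma lapPhi_deriv (γ x : ℝ) (hx : 0 < x) :
    HasDerivAt (lapPhi γ) (γ * (1 - x ^ (γ - 1))) x := by
  have h1 : HasDerivAt (fun x : ℝ => x ^ γ) (γ * x ^ (γ - 1)) x :=
    Real.hasDerivAt_rpow_const (Or.inl hx.ne')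
  have h2 : HasDerivAt (fun x : ℝ => γ * x + 1 - γ) γ x := by
    simpa using (((hasDerivAt_id x).const_mul γ).add_const 1).sub_const γ
  have := h2.sub h1
  exact this.congr_deriv (by ring)

lemma lapPhi_one (γ : ℝ) : lapPhi γ 1 = 0 := by simp [lapPhi]

lemma lap_bern_upper (γ x : ℝ) (h0 : 0 < γ) (h1 : γ < 1) (hx : 0 < x) :
    x ^ (γ - 1) ≤ 1 + (1 - γ) * (x⁻¹ - 1) := by
  have hi : 0 < x⁻¹ := inv_pos.2 hx
  have := rpow_one_add_le_one_add_mul_self (s := x⁻¹ - 1) (by linarith) (p := 1 - γ)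
    (by linarith) (by linarith)
  have e : (1 + (x⁻¹ - 1)) ^ (1 - γ) = x ^ (γ - 1) := by
    rw [add_sub_cancel, Real.inv_rpow hx.le, ← Real.rpow_neg hx.le, neg_sub]
  rwa [e] at this

lemma lap_bern_lower (γ x : ℝ) (h0 : 0 < γ) (h1 : γ < 1) (hx : 0 < x) :
    1 - (1 - γ) * (x - 1) ≤ x ^ (γ - 1) := by
  have := rpow_one_add_le_one_add_mul_self (s := x - 1) (by linarith) (p := 1 - γ)
    (by linarith) (by linarith)
  rw [add_sub_cancel] at this
  have e : x ^ (γ - 1) * x ^ (1 - γ) = 1 := by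
    rw [← Real.rpow_add hx]; simp
  have p1 : 0 < x ^ (γ - 1) := Real.rpow_pos_of_pos hx _
  have p2 : 0 < x ^ (1 - γ) := Real.rpow_pos_of_pos hx _
  nlinarith [sq_nonneg (x ^ (γ - 1) - 1), sq_nonneg (x ^ (1 - γ) - 1)]

lemma lapD_deriv (γ b d x : ℝ) (hx : 0 < x) :
    HasDerivAt (fun y => lapPhi γ y - b * (y - 1) ^ 2 + d * (y - 1) ^ 3)
      (γ * (1 - x ^ (γ - 1)) - 2 * b * (x - 1) + 3 * d * (x - 1) ^ 2) x := by
  have hs : HasDerivAt (fun y : ℝ => y - 1) 1 x := (hasDerivAt_id x).sub_const 1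
  have := ((lapPhi_deriv γ x hx).sub ((hs.pow 2).const_mul b)).add ((hs.pow 3).const_mul d)
  exact this.congr_deriv (by norm_num; ring)

lemma lap_cubic (γ y : ℝ) (h0 : 0 < γ) (h1 : γ < 1) (hy : 0 < y) :
    |lapPhi γ y - γ * (1 - γ) / 2 * (y - 1) ^ 2| ≤ 8 * |y - 1| ^ 3 := by
  have ha : 0 < γ * (1 - γ) := mul_pos h0 (by linarith)
  have ha1 : γ * (1 - γ) ≤ 1 := by nlinarith
  have up : ∀ x : ℝ, 0 < x → γ * (1 - x ^ (γ - 1)) - γ * (1 - γ) * (x - 1) ≤ 0 := by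
    intro x hx
    have := mul_le_mul_of_nonneg_left (lap_bern_lower γ x h0 h1 hx) h0.le
    nlinarith
  have lo : ∀ x : ℝ, 1 / 2 ≤ x →
      0 ≤ γ * (1 - x ^ (γ - 1)) - γ * (1 - γ) * (x - 1) + 2 * (γ * (1 - γ)) * (x - 1) ^ 2 := by
    intro x hx
    have hx0 : 0 < x := by linarith
    have h3 := mul_le_mul_of_nonneg_left (lap_bern_upper γ x h0 h1 hx0) h0.le
    have h4 : x⁻¹ ≤ 2 := by
      rw [inv_le_comm₀ hx0 two_pos]; linarith
    have h5 : x⁻¹ - 1 = -(x - 1) + (x - 1) ^ 2 * x⁻¹ := by field_simp; ring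
    have h6 : x⁻¹ - 1 ≤ -(x - 1) + 2 * (x - 1) ^ 2 := by
      rw [h5]; nlinarith [sq_nonneg (x - 1)]
    have h7 := mul_le_mul_of_nonneg_left h6 ha.le
    nlinarith
  rcases le_total 1 y with hy1 | hy1
  · have A := lap_right (fun y => -(lapPhi γ y - γ * (1 - γ) / 2 * (y - 1) ^ 2 + 0 * (y - 1) ^ 3)) _ y
      hy1 (fun x hx => (lapD_deriv γ _ _ x (by linarith)).neg) (by simp [lapPhi_one])
      (fun x hx => by have := up x (by linarith); linarith)
    have B := lap_right (fun y => (lapPhi γ y - γ * (1 - γ) / 2 * (y - 1) ^ 2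
      + (2 * (γ * (1 - γ)) / 3) * (y - 1) ^ 3)) _ y
      hy1 (fun x hx => (lapD_deriv γ _ _ x (by linarith))) (by simp [lapPhi_one])
      (fun x hx => by have := lo x (by linarith); linarith)
    have hc : 0 ≤ (y - 1) ^ 3 := pow_nonneg (by linarith) 3
    rw [abs_of_nonneg (by linarith : 0 ≤ y - 1), abs_le]
    constructor <;> nlinarith
  · have A := lap_left (fun y => (lapPhi γ y - γ * (1 - γ) / 2 * (y - 1) ^ 2 + 0 * (y - 1) ^ 3)) _ y
      hy1 (fun x hx _ => (lapD_deriv γ _ _ x (by linarith))) (by simp [lapPhi_one])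
      (fun x hx _ => by have := up x (by linarith); linarith)
    have hc : 0 ≤ (1 - y) ^ 3 := pow_nonneg (by linarith) 3
    rw [abs_of_nonpos (by linarith : y - 1 ≤ 0), abs_le]
    rcases le_total y (1 / 2) with hh | hh
    · have h8 : (1 / 2 : ℝ) ^ 3 ≤ (1 - y) ^ 3 := by gcongr; linarith
      have h9 : lapPhi γ y ≤ 1 := by
        have : 0 < y ^ γ := Real.rpow_pos_of_pos hy _
        unfold lapPhi; nlinarith
      have : 0 ≤ γ * (1 - γ) / 2 * (y - 1) ^ 2 := by positivity
      rw [neg_sub]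
      constructor <;> linarith
    · have B := lap_left (fun y => -(lapPhi γ y - γ * (1 - γ) / 2 * (y - 1) ^ 2
        + (2 * (γ * (1 - γ)) / 3) * (y - 1) ^ 3)) _ y
        hy1 (fun x hx _ => (lapD_deriv γ _ _ x (by linarith)).neg) (by simp [lapPhi_one])
        (fun x hx _ => by have := lo x (by linarith); linarith)
      rw [neg_sub]
      constructor <;> nlinarith

lemma lap_lower (γ y : ℝ) (h0 : 0 < γ) (h1 : γ < 1) (hy : 0 < y) :
    γ * (1 - γ) / 2 * ((y - 1) ^ 2 / (1 + |y - 1|)) ≤ lapPhi γ y := by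
  have ha : 0 < γ * (1 - γ) := mul_pos h0 (by linarith)
  rcases le_total 1 y with hy1 | hy1
  · rw [abs_of_nonneg (by linarith : 0 ≤ y - 1), add_sub_cancel]
    have A := lap_right (fun y => lapPhi γ y - γ * (1 - γ) / 2 * (y - 2 + y⁻¹))
      (fun x => γ * (1 - x ^ (γ - 1)) - γ * (1 - γ) / 2 * (1 + (-(x ^ 2)⁻¹))) y hy1
      (fun x hx => (lapPhi_deriv γ x (by linarith)).sub
        ((((hasDerivAt_id x).sub_const 2).add (hasDerivAt_inv (by linarith))).const_mul _))
      (by norm_num [lapPhi_one]) (by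
        intro x hx
        have hx0 : 0 < x := by linarith
        have h3 := mul_le_mul_of_nonneg_left (lap_bern_upper γ x h0 h1 hx0) h0.le
        have h4 : x⁻¹ ≤ 1 := inv_le_one_of_one_le₀ hx
        have h5 : 0 < x⁻¹ := inv_pos.2 hx0
        rw [← inv_pow]
        have h6 : 0 ≤ γ * (1 - γ) * (1 - x⁻¹) ^ 2 := by positivity
        nlinarith)
    have e : (y - 1) ^ 2 / y = y - 2 + y⁻¹ := by
      field_simp; ring
    rw [e]
    linarith
  · have A := lap_left (fun y => (lapPhi γ y - γ * (1 - γ) / 2 * (y - 1) ^ 2 + 0 * (y - 1) ^ 3)) _ y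
      hy1 (fun x hx _ => (lapD_deriv γ _ _ x (by linarith))) (by simp [lapPhi_one])
      (fun x hx _ => by
        have := mul_le_mul_of_nonneg_left (lap_bern_lower γ x h0 h1 (by linarith)) h0.le
        nlinarith)
    have : (y - 1) ^ 2 / (1 + |y - 1|) ≤ (y - 1) ^ 2 :=
      div_le_self (sq_nonneg _) (by linarith [abs_nonneg (y - 1)])
    nlinarith

lemma lap_integrable (n : ℕ) (hn : n ≠ 0) (c : ℝ) (hc : 0 < c) :
    Integrable (fun s : ℝ => |s| ^ n * Real.exp (-c * |s|)) := by
  have h := integrableOn_rpow_mul_exp_neg_mul_rpow (p := 1) (s := n) (b := c)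
    (by have : (0 : ℝ) ≤ n := n.cast_nonneg
        linarith) one_pos hc
  have h' := (integrable_indicator_iff measurableSet_Ioi).2 h
  refine (h'.add h'.comp_neg).congr (Eventually.of_forall fun x => ?_)
  simp only [Pi.add_apply, indicator, mem_Ioi, Real.rpow_one, Real.rpow_natCast, neg_pos]
  rcases lt_trichotomy x 0 with hx | hx | hx
  · simp [hx, abs_of_neg, not_lt.2 hx.le]
  · simp [hx, hn]
  · simp [hx, abs_of_pos, not_lt.2 hx.le]

lemma lap_integrable_half (k : ℕ) (c : ℝ) (hc : 0 < c) :
    IntegrableOn (fun x : ℝ => x ^ k * Real.exp (-c * x)) (Ioi 0) := by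
  have h := integrableOn_rpow_mul_exp_neg_mul_rpow (p := 1) (s := k) (b := c)
    (by have : (0 : ℝ) ≤ k := k.cast_nonneg
        linarith) one_pos hc
  simpa using h

lemma lap_exp_diff (A B m : ℝ) (hA : m ≤ A) (hB : m ≤ B) :
    |Real.exp (-A) - Real.exp (-B)| ≤ |A - B| * Real.exp (-m) := by
  wlog h : A ≤ B generalizing A B
  · rw [abs_sub_comm, abs_sub_comm A]
    exact this B A hB hA (le_of_not_ge h)
  have h1 : Real.exp (-B) ≤ Real.exp (-A) := Real.exp_le_exp.2 (by linarith)
  have h2 : Real.exp (-A) ≤ Real.exp (-m) := Real.exp_le_exp.2 (by linarith)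
  have h3 : Real.exp (-B) = Real.exp (-A) * Real.exp (-(B - A)) := by
    rw [← Real.exp_add]; ring_nf
  have h4 := Real.add_one_le_exp (-(B - A))
  rw [abs_of_nonneg (by linarith), abs_of_nonpos (by linarith)]
  have h5 := Real.exp_pos (-A)
  nlinarith

/-- The rescaled integrand. -/
noncomputable def lapH (γ : ℝ) (k : ℕ) (L : ℝ) : ℝ → ℝ :=
  indicator (Ioi 0) (fun y => y ^ k * Real.exp (-(L * lapPhi γ y)))

lemma lapH_measurable (γ : ℝ) (k : ℕ) (L : ℝ) : Measurable (lapH γ k L) := by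
  unfold lapH lapPhi
  exact Measurable.indicator (by fun_prop) measurableSet_Ioi

lemma lap_pow (k : ℕ) (hk : k ≤ 2) (t : ℝ) : |(1 + t) ^ k - 1| ≤ 2 * |t| + |t| ^ 2 := by
  have ht := abs_nonneg t
  interval_cases k
  · simp; positivity
  · simp; nlinarith
  · have : (1 + t) ^ 2 - 1 = 2 * t + t ^ 2 := by ring
    rw [this]
    refine (abs_add_le _ _).trans ?_
    simp [abs_mul]

lemma lap_pointwise (γ : ℝ) (h0 : 0 < γ) (h1 : γ < 1) (k : ℕ) (hk : k ≤ 2) (r : ℝ) (hr : 1 ≤ r)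
    (s : ℝ) :
    |lapH γ k (r ^ 2) (1 + r⁻¹ * s) - Real.exp (-(γ * (1 - γ) / 2) * s ^ 2)| ≤
      r⁻¹ * ((2 * |s| + |s| ^ 2 + 8 * |s| ^ 3) *
        (Real.exp (γ * (1 - γ) / 2) * Real.exp (-(γ * (1 - γ) / 2) * |s|))) := by
  set c := γ * (1 - γ) / 2 with hc
  have hc0 : 0 < c := by have := mul_pos h0 (sub_pos.2 h1); positivity
  set t := r⁻¹ * s with ht
  have hr0 : 0 < r := by linarith
  have hri : 0 < r⁻¹ := inv_pos.2 hr0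
  have hri1 : r⁻¹ ≤ 1 := inv_le_one_of_one_le₀ hr
  have hts : |t| = r⁻¹ * |s| := by rw [ht, abs_mul, abs_of_pos hri]
  have hs0 := abs_nonneg s
  have hst : s = r * t := by rw [ht]; field_simp
  have hst2 : s ^ 2 = r ^ 2 * t ^ 2 := by rw [hst]; ring
  have hle : |t| ≤ |s| := by rw [hts]; nlinarith
  have hss : c * (|s| - 1) ≤ c * s ^ 2 := by
    apply mul_le_mul_of_nonneg_left _ hc0.le
    rw [← sq_abs]; nlinarith [sq_nonneg (|s| - 1)]
  rw [← Real.exp_add]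
  have hexp : c + -c * |s| = -(c * (|s| - 1)) := by ring
  rw [hexp]
  set m := c * (|s| - 1) with hm
  have em := Real.exp_pos (-m)
  unfold lapH
  by_cases hpos : 0 < 1 + t
  · rw [indicator_of_mem (mem_Ioi.2 hpos)]
    have hlow := lap_lower γ (1 + t) h0 h1 hpos
    have hcub := lap_cubic γ (1 + t) h0 h1 hpos
    rw [add_sub_cancel_left, ← hc] at hlow hcub
    have hA : m ≤ r ^ 2 * lapPhi γ (1 + t) := by
      refine le_trans ?_ (mul_le_mul_of_nonneg_left hlow (by positivity))
      have : r ^ 2 * (c * (t ^ 2 / (1 + |t|))) = c * (s ^ 2 / (1 + |t|)) := by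
        rw [hst2]; ring
      rw [this, hm]
      apply mul_le_mul_of_nonneg_left _ hc0.le
      rw [le_div_iff₀ (by positivity), ← sq_abs s]
      rcases le_total 1 |s| with h | h
      · nlinarith [abs_nonneg t]
      · nlinarith [abs_nonneg t]
    have hd := lap_exp_diff _ _ m hA hss
    have hAB : |r ^ 2 * lapPhi γ (1 + t) - c * s ^ 2| ≤ r⁻¹ * (8 * |s| ^ 3) := by
      have : r ^ 2 * lapPhi γ (1 + t) - c * s ^ 2 = r ^ 2 * (lapPhi γ (1 + t) - c * t ^ 2) := by
        rw [hst2]; ring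
      rw [this, abs_mul, abs_of_pos (by positivity : 0 < r ^ 2)]
      refine (mul_le_mul_of_nonneg_left hcub (by positivity)).trans (le_of_eq ?_)
      rw [hts]; field_simp
    have hP : |(1 + t) ^ k - 1| ≤ r⁻¹ * (2 * |s| + |s| ^ 2) := by
      refine (lap_pow k hk t).trans ?_
      rw [hts, mul_pow]
      have : r⁻¹ ^ 2 ≤ r⁻¹ := by nlinarith
      have := mul_le_mul_of_nonneg_right this (sq_nonneg |s|)
      linarith
    have hE : Real.exp (-(r ^ 2 * lapPhi γ (1 + t))) ≤ Real.exp (-m) :=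
      Real.exp_le_exp.2 (by linarith)
    have e1 : (1 + t) ^ k * Real.exp (-(r ^ 2 * lapPhi γ (1 + t))) - Real.exp (-c * s ^ 2)
      = ((1 + t) ^ k - 1) * Real.exp (-(r ^ 2 * lapPhi γ (1 + t))) +
        (Real.exp (-(r ^ 2 * lapPhi γ (1 + t))) - Real.exp (-(c * s ^ 2))) := by
      rw [neg_mul]; ring
    rw [e1]
    refine (abs_add_le _ _).trans ?_
    rw [abs_mul, Real.abs_exp]
    have q1 := mul_le_mul hP hE (Real.exp_pos _).le (by positivity)
    have q2 := hd.trans (mul_le_mul_of_nonneg_right hAB em.le)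
    linarith
  · rw [indicator_of_notMem (by simpa using hpos), zero_sub, abs_neg, Real.abs_exp, neg_mul]
    have h2 : Real.exp (-(c * s ^ 2)) ≤ Real.exp (-m) := Real.exp_le_exp.2 (by linarith)
    have h3 : 1 ≤ |t| := by
      rw [abs_of_neg (by linarith)]; linarith
    rw [hts] at h3
    have h4 : 1 ≤ r⁻¹ * (2 * |s| + |s| ^ 2 + 8 * |s| ^ 3) := by
      have : 0 ≤ r⁻¹ * (|s| + |s| ^ 2 + 8 * |s| ^ 3) := by positivity
      linarith
    nlinarith

lemma lap_key (γ : ℝ) (h0 : 0 < γ) (h1 : γ < 1) (k : ℕ) (hk : k ≤ 2) :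
    ∃ C : ℝ, ∀ r : ℝ, 1 ≤ r →
      |(∫ s, lapH γ k (r ^ 2) (1 + r⁻¹ * s)) - Real.sqrt (2 * π / (γ * (1 - γ)))| ≤ C * r⁻¹ := by
  set c := γ * (1 - γ) / 2 with hc
  have ha := mul_pos h0 (sub_pos.2 h1)
  have hc0 : 0 < c := by positivity
  set G : ℝ → ℝ := fun s => (2 * |s| + |s| ^ 2 + 8 * |s| ^ 3) *
        (Real.exp c * Real.exp (-c * |s|)) with hG
  have hGi : Integrable G := by
    have := ((((lap_integrable 1 one_ne_zero c hc0).const_mul 2).add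
      (lap_integrable 2 two_ne_zero c hc0)).add
      ((lap_integrable 3 three_ne_zero c hc0).const_mul 8)).const_mul (Real.exp c)
    refine this.congr (Eventually.of_forall fun s => ?_)
    simp only [hG, Pi.add_apply]
    ring
  refine ⟨∫ s, G s, fun r hr => ?_⟩
  have hg : Integrable (fun s : ℝ => Real.exp (-c * s ^ 2)) := integrable_exp_neg_mul_sq hc0
  have hmeas : Measurable (fun s : ℝ => lapH γ k (r ^ 2) (1 + r⁻¹ * s)) :=
    (lapH_measurable γ k (r ^ 2)).comp (by fun_prop)
  have hpt := lap_pointwise γ h0 h1 k hk r hr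
  have hdi : Integrable (fun s : ℝ => lapH γ k (r ^ 2) (1 + r⁻¹ * s) - Real.exp (-c * s ^ 2)) := by
    refine (hGi.const_mul r⁻¹).mono' (hmeas.sub (by fun_prop)).aestronglyMeasurable
      (Eventually.of_forall fun s => ?_)
    exact hpt s
  have hHi : Integrable (fun s : ℝ => lapH γ k (r ^ 2) (1 + r⁻¹ * s)) := by
    refine (hdi.add hg).congr (Eventually.of_forall fun s => ?_)
    simp
  have e : Real.sqrt (2 * π / (γ * (1 - γ))) = ∫ s : ℝ, Real.exp (-c * s ^ 2) := by
    rw [integral_gaussian, hc]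
    congr 1
    field_simp
  rw [e, ← integral_sub hHi hg, mul_comm, ← integral_const_mul]
  rw [← Real.norm_eq_abs]
  refine norm_integral_le_of_norm_le (hGi.const_mul r⁻¹) (Eventually.of_forall fun s => ?_)
  exact hpt s

/-- Scaling of the exponent. -/
lemma lap_scale (γ ε x₀ y : ℝ) (hx : 0 < x₀) (hy : 0 < y) (he : ε * x₀ = γ * x₀ ^ γ) :
    (x₀ * y) ^ γ - ε * (x₀ * y) = (1 - γ) * x₀ ^ γ - x₀ ^ γ * lapPhi γ y := by
  rw [Real.mul_rpow hx.le hy.le, ← mul_assoc ε, he]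
  unfold lapPhi
  ring

lemma lap_x0 (γ ε : ℝ) (h0 : 0 < γ) (h1 : γ < 1) (hε : 0 < ε) :
    ε * (γ / ε) ^ (1 / (1 - γ)) = γ * ((γ / ε) ^ (1 / (1 - γ))) ^ γ := by
  have h2 : (1 - γ) ≠ 0 := by linarith
  have hp : 0 < γ / ε := by positivity
  rw [← Real.rpow_mul hp.le]
  have : 1 / (1 - γ) = 1 + 1 / (1 - γ) * γ := by field_simp; ring
  rw [this, Real.rpow_add hp, Real.rpow_one, ← this]
  field_simp

lemma lap_finite (γ : ℝ) (h0 : 0 < γ) (h1 : γ < 1) (k : ℕ) (ε : ℝ) (hε : 0 < ε) :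
    IntegrableOn (fun x : ℝ => x ^ k * Real.exp (x ^ γ - ε * x)) (Ioi 0) := by
  have hx0 : 0 < (γ / (ε / 2)) ^ (1 / (1 - γ)) := Real.rpow_pos_of_pos (by positivity) _
  have he := lap_x0 γ (ε / 2) h0 h1 (by positivity)
  set x₀ := (γ / (ε / 2)) ^ (1 / (1 - γ))
  have hi := (lap_integrable_half k (ε / 2) (by positivity)).const_mul
    (Real.exp ((1 - γ) * x₀ ^ γ))
  refine hi.mono' (by fun_prop) ?_
  refine (ae_restrict_iff' measurableSet_Ioi).2 (Eventually.of_forall fun x hx => ?_)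
  have hx : 0 < x := hx
  rw [Real.norm_of_nonneg (by positivity)]
  have hs := lap_scale γ (ε / 2) x₀ (x / x₀) hx0 (by positivity) he
  rw [mul_div_cancel₀ _ hx0.ne'] at hs
  have hl := lap_lower γ (x / x₀) h0 h1 (by positivity)
  have hl0 : 0 ≤ lapPhi γ (x / x₀) := by
    refine le_trans ?_ hl
    have ha := mul_pos h0 (sub_pos.2 h1)
    positivity
  have hl1 : 0 ≤ x₀ ^ γ * lapPhi γ (x / x₀) := by positivity
  have : Real.exp (x ^ γ - ε * x) ≤
      Real.exp ((1 - γ) * x₀ ^ γ) * Real.exp (-(ε / 2) * x) := by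
    rw [← Real.exp_add]
    exact Real.exp_le_exp.2 (by linarith)
  calc _ ≤ x ^ k * (Real.exp ((1 - γ) * x₀ ^ γ) * Real.exp (-(ε / 2) * x)) := by gcongr
    _ = _ := by ring

lemma lap_subst (γ : ℝ) (k : ℕ) (ε x₀ r : ℝ) (hx : 0 < x₀) (hr : 0 < r)
    (he : ε * x₀ = γ * x₀ ^ γ) (hrx : r ^ 2 = x₀ ^ γ) :
    (∫ x in Ioi (0 : ℝ), x ^ k * Real.exp (x ^ γ - ε * x)) =
      x₀ ^ (k + 1) * Real.exp ((1 - γ) * x₀ ^ γ) * r⁻¹ *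
        ∫ s, lapH γ k (r ^ 2) (1 + r⁻¹ * s) := by
  have e1 : (∫ s, lapH γ k (r ^ 2) (1 + r⁻¹ * s)) = r * ∫ y, lapH γ k (r ^ 2) y := by
    rw [Measure.integral_comp_mul_left (fun s => lapH γ k (r ^ 2) (1 + s)), inv_inv,
      abs_of_pos hr, integral_add_left_eq_self, smul_eq_mul]
  rw [e1, ← integral_indicator measurableSet_Ioi]
  set F := indicator (Ioi (0 : ℝ)) (fun x : ℝ => x ^ k * Real.exp (x ^ γ - ε * x)) with hF
  have e2 := Measure.integral_comp_mul_left F x₀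
  have e3 : ∀ y, F (x₀ * y) = x₀ ^ k * Real.exp ((1 - γ) * x₀ ^ γ) * lapH γ k (r ^ 2) y := by
    intro y
    unfold lapH
    by_cases hy : 0 < y
    · rw [hF, indicator_of_mem (mem_Ioi.2 hy), indicator_of_mem (mem_Ioi.2 (mul_pos hx hy)),
        lap_scale γ ε x₀ y hx hy he, hrx, mul_pow, sub_eq_add_neg, Real.exp_add]
      ring
    · have hy' : ¬ 0 < x₀ * y := by
        intro h; exact hy (pos_of_mul_pos_right h hx.le)
      rw [hF, indicator_of_notMem (by simpa using hy'), indicator_of_notMem (by simpa using hy),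
        mul_zero]
  simp_rw [e3] at e2
  rw [integral_const_mul, abs_of_pos (inv_pos.2 hx), smul_eq_mul] at e2
  have e4 : (∫ x, F x) = x₀ * (x₀⁻¹ * ∫ x, F x) := by field_simp
  rw [e4, ← e2]
  field_simp
  ring

lemma lap_denom (γ : ℝ) (h0 : 0 < γ) (h1 : γ < 1) (k : ℕ) (ε : ℝ) (hε : 0 < ε) :
    Real.sqrt (2 * π / (1 - γ)) * γ ^ (1 / (2 * (1 - γ)))
              * ε ^ (-(2 - γ) / (2 * (1 - γ)))
              * Real.exp ((1 - γ) * (γ / ε) ^ (γ / (1 - γ)))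
              * (γ / ε) ^ ((k : ℝ) / (1 - γ)) =
    ((γ / ε) ^ (1 / (1 - γ))) ^ (k + 1) * Real.exp ((1 - γ) * ((γ / ε) ^ (1 / (1 - γ))) ^ γ)
      * ((γ / ε) ^ (γ / (2 * (1 - γ))))⁻¹ * Real.sqrt (2 * π / (γ * (1 - γ))) := by
  have h2 : (1 - γ) ≠ 0 := by linarith
  have h3 : 0 < 1 - γ := by linarith
  have hp : 0 < γ / ε := by positivity
  have a1 : ((γ / ε) ^ (1 / (1 - γ))) ^ γ = (γ / ε) ^ (γ / (1 - γ)) := by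
    rw [← Real.rpow_mul hp.le]; congr 1; field_simp
  have a2 : ((γ / ε) ^ (1 / (1 - γ))) ^ (k + 1) =
      (γ / ε) ^ ((k : ℝ) / (1 - γ)) * (γ / ε) ^ (1 / (1 - γ)) := by
    rw [pow_succ]
    congr 1
    rw [← Real.rpow_natCast, ← Real.rpow_mul hp.le]; congr 1; field_simp
  have a3 : Real.sqrt (2 * π / (γ * (1 - γ))) = Real.sqrt (2 * π / (1 - γ)) * γ ^ (-(1 / 2) : ℝ) := by
    have : 2 * π / (γ * (1 - γ)) = 2 * π / (1 - γ) * γ⁻¹ := by field_simp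
    rw [this, Real.sqrt_mul (by positivity), Real.sqrt_inv, Real.sqrt_eq_rpow γ,
      Real.rpow_neg h0.le]
  have a4 : (γ / ε) ^ (1 / (1 - γ)) * ((γ / ε) ^ (γ / (2 * (1 - γ))))⁻¹ =
      γ ^ ((2 - γ) / (2 * (1 - γ))) * ε ^ (-(2 - γ) / (2 * (1 - γ))) := by
    rw [← Real.rpow_neg hp.le, ← Real.rpow_add hp]
    have : 1 / (1 - γ) + -(γ / (2 * (1 - γ))) = (2 - γ) / (2 * (1 - γ)) := by field_simp; ring
    rw [this, Real.div_rpow h0.le hε.le, neg_div, Real.rpow_neg hε.le, div_eq_mul_inv]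
  have a5 : γ ^ (1 / (2 * (1 - γ))) = γ ^ ((2 - γ) / (2 * (1 - γ))) * γ ^ (-(1 / 2) : ℝ) := by
    rw [← Real.rpow_add h0]; congr 1; field_simp; ring
  rw [a1, a2, a3, a5]
  calc _ = Real.sqrt (2 * π / (1 - γ)) * γ ^ (-(1 / 2) : ℝ)
        * Real.exp ((1 - γ) * (γ / ε) ^ (γ / (1 - γ))) * (γ / ε) ^ ((k : ℝ) / (1 - γ)) *
        (γ ^ ((2 - γ) / (2 * (1 - γ))) * ε ^ (-(2 - γ) / (2 * (1 - γ)))) := by ring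
    _ = _ := by rw [← a4]; ring

/-- for `γ ∈ (0,1)`, `ε > 0` and `k ∈ {0,1,2}`, the integral
`∫_0^∞ x^k e^{x^γ - εx} dx` is finite, and as `ε → 0` it equals
`√(2π/(1-γ)) γ^{1/(2(1-γ))} ε^{-(2-γ)/(2(1-γ))} exp((1-γ)(γ/ε)^{γ/(1-γ)})
  (γ/ε)^{k/(1-γ)} (1 + O(ε^{γ/(2(1-γ))}))`. -/
theorem laplace_method_asymptotics
    (γ : ℝ) (hγ : γ ∈ Ioo (0 : ℝ) 1) (k : ℕ) (hk : k ≤ 2) :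
    (∀ ε : ℝ, 0 < ε →
      IntegrableOn (fun x : ℝ => x ^ k * Real.exp (x ^ γ - ε * x))
        (Ioi 0)) ∧
    (fun ε : ℝ =>
        (∫ x in Ioi (0 : ℝ), x ^ k * Real.exp (x ^ γ - ε * x))
          / (Real.sqrt (2 * π / (1 - γ)) * γ ^ (1 / (2 * (1 - γ)))
              * ε ^ (-(2 - γ) / (2 * (1 - γ)))
              * Real.exp ((1 - γ) * (γ / ε) ^ (γ / (1 - γ)))
              * (γ / ε) ^ ((k : ℝ) / (1 - γ)))
          - 1)
      =O[𝓝[>] (0 : ℝ)] fun ε : ℝ => ε ^ (γ / (2 * (1 - γ))) := by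
  obtain ⟨h0, h1⟩ := hγ
  refine ⟨fun ε hε => lap_finite γ h0 h1 k ε hε, ?_⟩
  obtain ⟨C, hC⟩ := lap_key γ h0 h1 k hk
  have h3 : 0 < 1 - γ := by linarith
  set S := Real.sqrt (2 * π / (γ * (1 - γ))) with hS
  have hS0 : 0 < S := Real.sqrt_pos.2 (by positivity)
  apply IsBigO.of_bound (S⁻¹ * C * (γ ^ (γ / (2 * (1 - γ))))⁻¹)
  filter_upwards [Ioo_mem_nhdsGT h0] with ε hε
  obtain ⟨hε, hεγ⟩ := hε
  have hp : 0 < γ / ε := by positivity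
  rw [lap_denom γ h0 h1 k ε hε]
  have hx0 : 0 < (γ / ε) ^ (1 / (1 - γ)) := Real.rpow_pos_of_pos hp _
  have he := lap_x0 γ ε h0 h1 hε
  have hr1 : 1 ≤ (γ / ε) ^ (γ / (2 * (1 - γ))) :=
    Real.one_le_rpow ((one_le_div hε).2 hεγ.le) (by positivity)
  have hrx : ((γ / ε) ^ (γ / (2 * (1 - γ)))) ^ 2 = ((γ / ε) ^ (1 / (1 - γ))) ^ γ := by
    rw [← Real.rpow_natCast, ← Real.rpow_mul hp.le, ← Real.rpow_mul hp.le]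
    congr 1
    push_cast
    field_simp
  have hrinv : ((γ / ε) ^ (γ / (2 * (1 - γ))))⁻¹ =
      (γ ^ (γ / (2 * (1 - γ))))⁻¹ * ε ^ (γ / (2 * (1 - γ))) := by
    rw [Real.div_rpow h0.le hε.le, inv_div, div_eq_mul_inv, mul_comm]
  have hb := hC _ hr1
  rw [lap_subst γ k ε _ _ hx0 (by linarith) he hrx]
  set x₀ := (γ / ε) ^ (1 / (1 - γ))
  set r := (γ / ε) ^ (γ / (2 * (1 - γ)))
  have hr0 : 0 < r := by linarith
  rw [mul_div_mul_left _ _ (by positivity), ← hS, div_sub_one hS0.ne', norm_div,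
    Real.norm_of_nonneg hS0.le, Real.norm_of_nonneg (Real.rpow_nonneg hε.le _), div_eq_inv_mul,
    mul_assoc, mul_assoc, ← hrinv]
  exact mul_le_mul_of_nonneg_left hb (inv_nonneg.2 hS0.le)
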